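/- For unit vectors ψ⃗, ϕ⃗ on the sphere S² ⊂ ℝ³, the integral over the sphere of (1/π)·Θ(ψ⃗·λ⃗)·(ψ⃗·λ⃗)·Θ(ϕ⃗·λ⃗) with respect to the surface measure equals (1/2)(1 + ψ⃗·ϕ⃗), where Θ is the Heaviside step function. -/

import Mathlib

open MeasureTheory Real
open scoped RealInnerProductSpace

/-- The Heaviside step function. -/
noncomputable def heaviside (t : ℝ) : ℝ := if 0 ≤ t then 1 else 0

section PolarCoordinates

variable {E : Type*} [NormedAddCommGroup E] [NormedSpace ℝ E] [MeasurableSpace E] [BorelSpace E]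
  [FiniteDimensional ℝ E] [Nontrivial E]

/-- Polar coordinates for a positively homogeneous function of degree one times a radial weight. -/
theorem integral_homogeneous_mul_radial (μ : Measure E) [μ.IsAddHaarMeasure] {f : E → ℝ}
    (hf : ∀ r : ℝ, 0 < r → ∀ x, f (r • x) = r * f x) (g : ℝ → ℝ) :
    ∫ x, f x * g ‖x‖ ∂μ = (∫ u : Metric.sphere (0 : E) 1, f u ∂μ.toSphere) *
      ∫ r in Set.Ioi (0 : ℝ), r ^ (Module.finrank ℝ E - 1) * (r * g r) := by
  calc
    ∫ x, f x * g ‖x‖ ∂μ = ∫ x : ({(0)}ᶜ : Set E), f x * g ‖x.1‖ ∂(μ.comap (↑)) := by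
      rw [integral_subtype_comap (measurableSet_singleton _).compl fun x ↦ f x * g ‖x‖,
        restrict_compl_singleton]
    _ = ∫ p : Metric.sphere (0 : E) 1 × Set.Ioi (0 : ℝ), f p.1 * (p.2 * g p.2)
          ∂(μ.toSphere.prod (.volumeIoiPow (Module.finrank ℝ E - 1))) := by
      rw [← μ.measurePreserving_homeomorphUnitSphereProd.integral_comp
        (Homeomorph.measurableEmbedding _)]
      refine integral_congr_ae (.of_forall fun x ↦ ?_)
      have hx : 0 < ‖x.1‖ := norm_pos_iff.2 x.2
      simp only [homeomorphUnitSphereProd_apply_fst_coe, homeomorphUnitSphereProd_apply_snd_coe]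
      rw [hf _ (inv_pos.2 hx)]
      field_simp
    _ = _ := by
      rw [integral_prod_mul (fun u : Metric.sphere (0 : E) 1 ↦ f u)
        (fun r : Set.Ioi (0 : ℝ) ↦ (r : ℝ) * g r), Measure.volumeIoiPow,
        integral_withDensity_eq_integral_toReal_smul (by fun_prop) (by simp),
        integral_subtype_comap measurableSet_Ioi
          fun a : ℝ ↦ (ENNReal.ofReal (a ^ (Module.finrank ℝ E - 1))).toReal • (a * g a)]
      congr 1
      refine setIntegral_congr_fun measurableSet_Ioi fun r hr ↦ ?_
      simp only [smul_eq_mul]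
      rw [ENNReal.toReal_ofReal (pow_nonneg (le_of_lt hr) _)]

end PolarCoordinates

section Gaussian

variable {E : Type*} [NormedAddCommGroup E] [InnerProductSpace ℝ E] [MeasurableSpace E]
  [BorelSpace E] [FiniteDimensional ℝ E]

theorem integrable_norm_mul_exp_neg_sq [Nontrivial E] :
    Integrable (fun x : E ↦ ‖x‖ * exp (-‖x‖ ^ 2)) := by
  rw [integrable_fun_norm_addHaar (volume : Measure E) (f := fun r ↦ r * exp (-r ^ 2))]
  have h := integrableOn_rpow_mul_exp_neg_rpow
    (s := (Module.finrank ℝ E - 1 + 1 : ℕ)) (p := 2)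
    (neg_one_lt_zero.trans_le (Nat.cast_nonneg _)) two_pos
  refine h.congr_fun (fun r _ ↦ ?_) measurableSet_Ioi
  simp only [smul_eq_mul]
  norm_cast
  rw [pow_succ, mul_assoc]

theorem ae_inner_ne_zero {v : E} (hv : v ≠ 0) : ∀ᵐ x : E, ⟪v, x⟫ ≠ 0 := by
  have h : (innerSL ℝ v).ker ≠ ⊤ := fun h ↦ hv <| by
    have : v ∈ (innerSL ℝ v).ker := h ▸ Submodule.mem_top
    simpa using this
  have := Measure.addHaar_submodule (volume : Measure E) _ h
  rw [ae_iff]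
  convert this using 2
  ext x
  simp

theorem measurable_heaviside : Measurable heaviside :=
  Measurable.ite measurableSet_Ici measurable_const measurable_const

theorem abs_heaviside_le_one (t : ℝ) : |heaviside t| ≤ 1 := by
  unfold heaviside; split_ifs <;> simp

theorem integrable_mul_exp_neg_sq [Nontrivial E] {f : E → ℝ} (hf : Measurable f)
    (hle : ∀ x, |f x| ≤ ‖x‖) : Integrable (fun x : E ↦ f x * exp (-‖x‖ ^ 2)) := by
  refine integrable_norm_mul_exp_neg_sq.mono' (hf.mul (by fun_prop)).aestronglyMeasurable
    (.of_forall fun x ↦ ?_)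
  rw [norm_eq_abs, abs_mul, abs_exp]
  gcongr
  exact hle x

theorem integrable_heaviside_inner_mul_inner [Nontrivial E] {ψ : E} (φ : E) (hψ : ‖ψ‖ = 1) :
    Integrable (fun x : E ↦ heaviside ⟪ψ, x⟫ * ⟪ψ, x⟫ * heaviside ⟪φ, x⟫ * exp (-‖x‖ ^ 2)) := by
  have hm (v : E) : Measurable fun x ↦ heaviside ⟪v, x⟫ :=
    measurable_heaviside.comp (by fun_prop)
  refine integrable_mul_exp_neg_sq (((hm ψ).mul (by fun_prop)).mul (hm φ)) fun x ↦ ?_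
  rw [abs_mul, abs_mul]
  calc |heaviside ⟪ψ, x⟫| * |⟪ψ, x⟫| * |heaviside ⟪φ, x⟫| ≤ 1 * ‖x‖ * 1 := by
        gcongr
        · exact abs_heaviside_le_one _
        · simpa [hψ] using abs_real_inner_le_norm ψ x
        · exact abs_heaviside_le_one _
    _ = ‖x‖ := by ring

theorem integrable_inner_mul_sign_inner [Nontrivial E] {ψ : E} (φ : E) (hψ : ‖ψ‖ = 1) :
    Integrable (fun x : E ↦ ⟪ψ, x⟫ * SignType.sign ⟪φ, x⟫ * exp (-‖x‖ ^ 2)) := by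
  have hm : Measurable fun t : ℝ ↦ ((SignType.sign t : SignType) : ℝ) := by
    simp only [sign_apply, apply_ite (SignType.cast : SignType → ℝ)]
    exact .ite measurableSet_Ioi measurable_const
      (.ite measurableSet_Iio measurable_const measurable_const)
  refine integrable_mul_exp_neg_sq (.mul (by fun_prop) (hm.comp (by fun_prop))) fun x ↦ ?_
  rw [abs_mul]
  have h : |⟪ψ, x⟫| ≤ ‖x‖ := by simpa [hψ] using abs_real_inner_le_norm ψ x
  refine (mul_le_of_le_one_right (abs_nonneg _) ?_).trans h
  cases SignType.sign ⟪φ, x⟫ <;> simp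

/-- Reflecting in the line spanned by `φ` shows that `∫ ⟪ψ, x⟫ * sign ⟪φ, x⟫` against a Gaussian is
`⟪ψ, φ⟫` times its value at `ψ = φ`. -/
theorem integral_inner_mul_sign_inner [Nontrivial E] {ψ φ : E} (hψ : ‖ψ‖ = 1) (hφ : ‖φ‖ = 1) :
    ∫ x : E, ⟪ψ, x⟫ * SignType.sign ⟪φ, x⟫ * exp (-‖x‖ ^ 2) =
      ⟪ψ, φ⟫ * ∫ x : E, |⟪φ, x⟫| * exp (-‖x‖ ^ 2) := by
  have hi := integrable_inner_mul_sign_inner φ hψ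
  have hA := integrable_inner_mul_sign_inner φ hφ
  have h := (ℝ ∙ φ).reflection.measurePreserving.integral_comp
    (ℝ ∙ φ).reflection.toHomeomorph.measurableEmbedding
    (fun x : E ↦ ⟪ψ, x⟫ * SignType.sign ⟪φ, x⟫ * exp (-‖x‖ ^ 2))
  have h₂ : ∀ x : E, ⟪ψ, (ℝ ∙ φ).reflection x⟫ * SignType.sign ⟪φ, (ℝ ∙ φ).reflection x⟫ *
        exp (-‖(ℝ ∙ φ).reflection x‖ ^ 2) =
      2 * ⟪ψ, φ⟫ * (⟪φ, x⟫ * SignType.sign ⟪φ, x⟫ * exp (-‖x‖ ^ 2)) -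
        ⟪ψ, x⟫ * SignType.sign ⟪φ, x⟫ * exp (-‖x‖ ^ 2) := fun x ↦ by
    have h₃ : ⟪φ, (ℝ ∙ φ).reflection x⟫ = ⟪φ, x⟫ := by
      simp [Submodule.reflection_singleton_apply, two_smul, inner_add_right, inner_sub_right,
        inner_smul_right, hφ]
    rw [h₃, LinearIsometryEquiv.norm_map, Submodule.reflection_singleton_apply]
    simp [two_smul, inner_add_right, inner_sub_right, inner_smul_right, hφ, -self_mul_sign]
    ring
  simp_rw [h₂] at h
  rw [integral_sub (hA.const_mul _) hi, integral_const_mul] at h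
  simp_rw [self_mul_sign] at h
  linarith

theorem integral_heaviside_inner_mul_inner_mul_heaviside_inner [Nontrivial E] {ψ φ : E}
    (hψ : ‖ψ‖ = 1) (hφ : ‖φ‖ = 1) :
    ∫ x : E, heaviside ⟪ψ, x⟫ * ⟪ψ, x⟫ * heaviside ⟪φ, x⟫ * exp (-‖x‖ ^ 2) =
      ((∫ x : E, |⟪ψ, x⟫| * exp (-‖x‖ ^ 2)) +
        ∫ x : E, ⟪ψ, x⟫ * SignType.sign ⟪φ, x⟫ * exp (-‖x‖ ^ 2)) / 4 := by
  have hi := integrable_heaviside_inner_mul_inner φ hψ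
  have hA := integrable_inner_mul_sign_inner ψ hψ
  simp_rw [self_mul_sign] at hA
  have h := integral_neg_eq_self
    (fun x : E ↦ heaviside ⟪ψ, x⟫ * ⟪ψ, x⟫ * heaviside ⟪φ, x⟫ * exp (-‖x‖ ^ 2)) volume
  have hsum := integral_add hi hi.comp_neg
  rw [← integral_add hA (integrable_inner_mul_sign_inner φ hψ)]
  have : ∫ x : E, (heaviside ⟪ψ, x⟫ * ⟪ψ, x⟫ * heaviside ⟪φ, x⟫ * exp (-‖x‖ ^ 2) +
      heaviside ⟪ψ, -x⟫ * ⟪ψ, -x⟫ * heaviside ⟪φ, -x⟫ * exp (-‖-x‖ ^ 2)) =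
      ∫ x : E, (|⟪ψ, x⟫| * exp (-‖x‖ ^ 2) + ⟪ψ, x⟫ * SignType.sign ⟪φ, x⟫ * exp (-‖x‖ ^ 2)) / 2 := by
    refine integral_congr_ae ?_
    filter_upwards [ae_inner_ne_zero (show φ ≠ 0 by rintro rfl; simp at hφ)] with x hx
    simp only [inner_neg_right, norm_neg]
    generalize ⟪ψ, x⟫ = a
    unfold heaviside
    rcases hx.lt_or_gt with hx | hx <;> rcases lt_trichotomy a 0 with ha | rfl | ha <;>
      simp [*, le_of_lt, not_le_of_gt, abs_of_pos, abs_of_neg]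
  rw [integral_div] at this
  linarith

theorem integral_abs_inner_mul_exp_neg_sq {u : EuclideanSpace ℝ (Fin 3)} (hu : ‖u‖ = 1) :
    ∫ x : EuclideanSpace ℝ (Fin 3), |⟪u, x⟫| * exp (-‖x‖ ^ 2) = π := by
  obtain ⟨b, hb⟩ := Orthonormal.exists_orthonormalBasis_extension_of_card_eq (𝕜 := ℝ)
    (E := EuclideanSpace ℝ (Fin 3)) (ι := Fin 3) (by simp) (v := fun _ ↦ u) (s := {0})
    (by simp [Set.domRestrict, hu])
  have hb0 : b 0 = u := hb 0 rfl
  have h1 := b.measurePreserving_repr.integral_comp b.repr.toHomeomorph.measurableEmbedding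
    (fun y : EuclideanSpace ℝ (Fin 3) ↦ |y 0| * exp (-‖y‖ ^ 2))
  simp only [b.repr_apply_apply, hb0, LinearIsometryEquiv.norm_map] at h1
  have h2 := (EuclideanSpace.volume_preserving_symm_measurableEquiv_toLp (Fin 3)).symm.integral_comp
    (MeasurableEquiv.measurableEmbedding _)
    (fun y : EuclideanSpace ℝ (Fin 3) ↦ |y 0| * exp (-‖y‖ ^ 2))
  have h3 := integral_fintype_prod_volume_eq_prod (ι := Fin 3) (𝕜 := ℝ)
    (![fun t ↦ |t| * exp (-t ^ 2), fun t ↦ exp (-t ^ 2), fun t ↦ exp (-t ^ 2)] : Fin 3 → ℝ → ℝ)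
  have hg : ∫ t : ℝ, exp (-t ^ 2) = √π := by simpa using integral_gaussian 1
  have habs : ∫ t : ℝ, |t| * exp (-t ^ 2) = 1 := by
    have h := integral_comp_abs (f := fun t ↦ t * exp (-t ^ 2))
    have h' := integral_rpow_mul_exp_neg_rpow (p := 2) (q := 1) two_pos (by norm_num)
    norm_num at h'
    simp only [sq_abs] at h
    rw [h, h']
    norm_num
  simp [Fin.prod_univ_three, hg, habs] at h3
  refine h1.trans (h2.symm.trans (Eq.trans ?_ (h3.trans (mul_self_sqrt pi_pos.le))))
  congr 1
  ext x
  simp [EuclideanSpace.norm_sq_eq, Fin.sum_univ_three, exp_add]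
  ring

end Gaussian

/-- The Kochen–Specker qubit model reproduces the Born rule: for unit vectors ψ, ϕ on the
sphere S² ⊂ ℝ³, integrating the epistemic state density (1/π)Θ(ψ·λ)(ψ·λ) against the
indicator function Θ(ϕ·λ) over the sphere (with its surface measure) gives (1/2)(1+ψ·ϕ). -/
theorem stmt5 (ψ φ : Metric.sphere (0 : EuclideanSpace ℝ (Fin 3)) 1) :
    ∫ l : Metric.sphere (0 : EuclideanSpace ℝ (Fin 3)) 1,
        (1 / π) * heaviside ⟪(ψ : EuclideanSpace ℝ (Fin 3)), (l : EuclideanSpace ℝ (Fin 3))⟫ *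
          ⟪(ψ : EuclideanSpace ℝ (Fin 3)), (l : EuclideanSpace ℝ (Fin 3))⟫ *
          heaviside ⟪(φ : EuclideanSpace ℝ (Fin 3)), (l : EuclideanSpace ℝ (Fin 3))⟫
        ∂((volume : Measure (EuclideanSpace ℝ (Fin 3))).toSphere)
      = (1 + ⟪(ψ : EuclideanSpace ℝ (Fin 3)), (φ : EuclideanSpace ℝ (Fin 3))⟫) / 2 := by
  obtain ⟨ψ, hψ⟩ := ψ
  obtain ⟨φ, hφ⟩ := φ
  rw [mem_sphere_zero_iff_norm] at hψ hφ
  have hhom : ∀ r : ℝ, 0 < r → ∀ x : EuclideanSpace ℝ (Fin 3),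
      heaviside ⟪ψ, r • x⟫ * ⟪ψ, r • x⟫ * heaviside ⟪φ, r • x⟫ =
        r * (heaviside ⟪ψ, x⟫ * ⟪ψ, x⟫ * heaviside ⟪φ, x⟫) := fun r hr x ↦ by
    simp only [inner_smul_right, heaviside, mul_nonneg_iff_of_pos_left hr]
    ring
  have hpolar := integral_homogeneous_mul_radial volume
    (f := fun x ↦ heaviside ⟪ψ, x⟫ * ⟪ψ, x⟫ * heaviside ⟪φ, x⟫) hhom fun r ↦ exp (-r ^ 2)
  have hr : ∫ r in Set.Ioi (0 : ℝ), r ^ 2 * (r * exp (-r ^ 2)) = 1 / 2 := by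
    have h := integral_rpow_mul_exp_neg_rpow (p := 2) (q := 3) two_pos (by norm_num)
    norm_num at h
    rw [← h]
    congr 1
    ext r
    ring
  rw [integral_heaviside_inner_mul_inner_mul_heaviside_inner hψ hφ,
    integral_inner_mul_sign_inner hψ hφ, integral_abs_inner_mul_exp_neg_sq hψ,
    integral_abs_inner_mul_exp_neg_sq hφ, finrank_euclideanSpace_fin, hr] at hpolar
  simp_rw [mul_assoc (1 / π)]
  rw [integral_const_mul]
  field_simp
  linarith
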